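/- Let N ≥ 3 and 0 < μ < μ₀ = (N-2)²/4. There exists β* > 1, depending only on N and μ, such that for every potential V satisfying Assumption (Ṽ) with liminf_{|x|→+∞} V(x)|x|² = β > β*, the operator L_{μV} = -Δ - μV admits no positive fundamental solution; that is, there is no positive classical solution u of -Δu - μVu = 0 in ℝ^N∖{0} satisfying the dμ-distributional identity with some constant k > 0. -/

import Mathlib

open Filter MeasureTheory Metric

noncomputable section

/-- Euclidean space ℝ^N. -/
abbrev Euc (N : ℕ) : Type := EuclideanSpace ℝ (Fin N)

/-- The Laplacian of `u` at `x`, as the sum of the pure second derivatives in the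
coordinate directions. -/
def lap {N : ℕ} (u : Euc N → ℝ) (x : Euc N) : ℝ :=
  ∑ i : Fin N, fderiv ℝ (fun y => fderiv ℝ u y (EuclideanSpace.single i 1)) x
    (EuclideanSpace.single i 1)

/-- μ₀ = (N-2)²/4. -/
def mu0 (N : ℕ) : ℝ := ((N : ℝ) - 2) ^ 2 / 4

/-- τ₋(μ) = -(N-2)/2 - √(μ₀-μ). -/
def tauMinus (N : ℕ) (μ : ℝ) : ℝ := -((N : ℝ) - 2) / 2 - Real.sqrt (mu0 N - μ)

/-- τ₊(μ) = -(N-2)/2 + √(μ₀-μ). -/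
def tauPlus (N : ℕ) (μ : ℝ) : ℝ := -((N : ℝ) - 2) / 2 + Real.sqrt (mu0 N - μ)

/-- Surface area of the unit sphere in ℝ^N, i.e. N times the volume of the unit ball. -/
def sphereArea (N : ℕ) : ℝ := N * (volume (ball (0 : Euc N) 1)).toReal

/-- The normalizing constant c_μ: 2√(μ₀-μ)|𝕊^{N-1}| for μ < μ₀ and |𝕊^{N-1}| for μ = μ₀. -/
def cMu (N : ℕ) (μ : ℝ) : ℝ :=
  if μ < mu0 N then 2 * Real.sqrt (mu0 N - μ) * sphereArea N else sphereArea N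

/-- The normalizing constant c_N = ((N-2)|𝕊^{N-1}|)⁻¹ of the fundamental solution of -Δ. -/
def cN (N : ℕ) : ℝ := (((N : ℝ) - 2) * sphereArea N)⁻¹

/-- The singular profile Φ_μ: |x|^{τ₋(μ)} for μ < μ₀ and |x|^{-(N-2)/2}(-ln|x|) for μ = μ₀. -/
def PhiFun (N : ℕ) (μ : ℝ) (x : Euc N) : ℝ :=
  if μ < mu0 N then ‖x‖ ^ tauMinus N μ
  else ‖x‖ ^ (-((N : ℝ) - 2) / 2) * (-Real.log ‖x‖)

/-- The adjoint operator L*_μ ξ(x) = -Δξ(x) - 2τ₊(μ)|x|⁻² x·∇ξ(x). -/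
def LstarMu (N : ℕ) (μ : ℝ) (ξ : Euc N → ℝ) (x : Euc N) : ℝ :=
  -lap ξ x - 2 * tauPlus N μ / ‖x‖ ^ 2 * fderiv ℝ ξ x x

/-- The adjoint operator L*_{μV} ξ = L*_μ ξ - μ(V - |x|⁻²)ξ. -/
def LstarMuV (N : ℕ) (μ : ℝ) (V ξ : Euc N → ℝ) (x : Euc N) : ℝ :=
  LstarMu N μ ξ x - μ * (V x - ‖x‖ ^ (-2 : ℝ)) * ξ x

/-- A compactly supported C^{1,1} test function: compactly supported, differentiable,
with Lipschitz gradient. -/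
def IsC11c {N : ℕ} (ξ : Euc N → ℝ) : Prop :=
  HasCompactSupport ξ ∧ Differentiable ℝ ξ ∧ ∃ L : NNReal, LipschitzWith L (fderiv ℝ ξ)

/-- The dμ-distributional identity with constant `k`. -/
def DistribIdentity (N : ℕ) (μ : ℝ) (V u : Euc N → ℝ) (k : ℝ) : Prop :=
  ∀ ξ : Euc N → ℝ, IsC11c ξ →
    ∫ x : Euc N, u x * LstarMuV N μ V ξ x * ‖x‖ ^ tauPlus N μ = cMu N μ * k * ξ 0

/-- `u` is a classical solution of -Δu - μVu = 0 in ℝ^N∖{0}. -/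
def IsSolution (N : ℕ) (μ : ℝ) (V u : Euc N → ℝ) : Prop :=
  ContDiffOn ℝ 2 u {x : Euc N | x ≠ 0} ∧
  ∀ x : Euc N, x ≠ 0 → -lap u x - μ * V x * u x = 0

/-- `f` is locally γ-Hölder continuous on `s`. -/
def LocHolderOn {N : ℕ} (γ : ℝ) (s : Set (Euc N)) (f : Euc N → ℝ) : Prop :=
  ∀ x ∈ s, ∃ ε > 0, ∃ C > 0, ∀ y ∈ ball x ε ∩ s, ∀ z ∈ ball x ε ∩ s,
    |f y - f z| ≤ C * dist y z ^ γ

/-- The filter `‖x‖ → +∞` on ℝ^N. -/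
def normAtTop (N : ℕ) : Filter (Euc N) := comap norm atTop

/-- Assumption (V): V is locally Hölder and positive on ℝ^N∖{0},
0 ≤ V(x) - |x|⁻² ≤ c₀, and limsup_{|x|→∞} V(x)|x|² = α. -/
def AssumpV (N : ℕ) (V : Euc N → ℝ) (α : ℝ) : Prop :=
  (∃ γ : ℝ, 0 < γ ∧ γ < 1 ∧ LocHolderOn γ {x : Euc N | x ≠ 0} V) ∧
  (∀ x : Euc N, x ≠ 0 → 0 < V x) ∧
  (∃ c₀ : ℝ, 0 < c₀ ∧ ∀ x : Euc N, x ≠ 0 →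
    0 ≤ V x - ‖x‖ ^ (-2 : ℝ) ∧ V x - ‖x‖ ^ (-2 : ℝ) ≤ c₀) ∧
  limsup (fun x : Euc N => V x * ‖x‖ ^ 2) (normAtTop N) = α

/-- Assumption (Ṽ): V is locally Hölder and positive on ℝ^N∖{0},
0 ≤ V(x) - |x|⁻² ≤ c₀, and liminf_{|x|→∞} V(x)|x|² = β. -/
def AssumpVtilde (N : ℕ) (V : Euc N → ℝ) (β : ℝ) : Prop :=
  (∃ γ : ℝ, 0 < γ ∧ γ < 1 ∧ LocHolderOn γ {x : Euc N | x ≠ 0} V) ∧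
  (∀ x : Euc N, x ≠ 0 → 0 < V x) ∧
  (∃ c₀ : ℝ, 0 < c₀ ∧ ∀ x : Euc N, x ≠ 0 →
    0 ≤ V x - ‖x‖ ^ (-2 : ℝ) ∧ V x - ‖x‖ ^ (-2 : ℝ) ≤ c₀) ∧
  liminf (fun x : Euc N => V x * ‖x‖ ^ 2) (normAtTop N) = β

/-- The potential V_ρ(x) = |x|⁻²(1 + ρ|x|²)/(1 + |x|²). -/
def Vrho (N : ℕ) (ρ : ℝ) (x : Euc N) : ℝ :=
  ‖x‖ ^ (-2 : ℝ) * (1 + ρ * ‖x‖ ^ 2) / (1 + ‖x‖ ^ 2)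

/-- Ω has C² boundary: it is the sublevel set of a C² function whose differential
does not vanish on the boundary. -/
def HasC2Boundary {N : ℕ} (Ω : Set (Euc N)) : Prop :=
  ∃ φ : Euc N → ℝ, ContDiff ℝ 2 φ ∧ Ω = {x | φ x < 0} ∧
    ∀ x ∈ frontier Ω, fderiv ℝ φ x ≠ 0

/-- At a local minimum, the pure second derivative in every direction is nonnegative. -/
theorem IsLocalMin.fderiv_fderiv_apply_nonneg {E : Type*} [NormedAddCommGroup E]
    [NormedSpace ℝ E] {h : E → ℝ} {x : E} (hmin : IsLocalMin h x) (hh : ContDiffAt ℝ 2 h x)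
    (v : E) : 0 ≤ fderiv ℝ (fun y => fderiv ℝ h y v) x v := by
  set g : ℝ → ℝ := fun t => h (x + t • v) with hg
  have hline (t : ℝ) : HasDerivAt (fun t : ℝ => x + t • v) v t := by
    simpa using ((hasDerivAt_id t).smul_const v).const_add x
  have htend : Tendsto (fun t : ℝ => x + t • v) (nhds 0) (nhds x) := by
    have := (hline 0).continuousAt.tendsto
    simpa using this
  have hdiff : ∀ᶠ y in nhds x, DifferentiableAt ℝ h y :=
    (hh.eventually (by simp)).mono fun y hy => hy.differentiableAt (by norm_num)
  have hderiv : deriv g =ᶠ[nhds 0] fun t => fderiv ℝ h (x + t • v) v := by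
    filter_upwards [htend.eventually hdiff] with t ht
    exact (ht.hasFDerivAt.comp_hasDerivAt t (hline t)).deriv
  have hF : DifferentiableAt ℝ (fun y => fderiv ℝ h y v) x :=
    ((hh.fderiv_right (m := 1) (by norm_num)).differentiableAt (by norm_num)).clm_apply
      (differentiableAt_const v)
  have hdd : deriv (deriv g) 0 = fderiv ℝ (fun y => fderiv ℝ h y v) x v := by
    rw [hderiv.deriv_eq]
    have hF' : HasFDerivAt (fun y => fderiv ℝ h y v)
        (fderiv ℝ (fun y => fderiv ℝ h y v) x) (x + (0 : ℝ) • v) := by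
      simpa using hF.hasFDerivAt
    exact (hF'.comp_hasDerivAt 0 (hline 0)).deriv
  have hgmin : IsLocalMin g 0 := by
    have : ∀ᶠ t in nhds (0 : ℝ), h x ≤ h (x + t • v) := htend.eventually hmin
    simpa [IsLocalMin, IsMinFilter, hg] using this
  have hgc : ContinuousAt g 0 := by
    have hc : ContinuousAt h (x + (0 : ℝ) • v) := by simpa using hh.continuousAt
    exact hc.comp (f := fun t : ℝ => x + t • v) (hline 0).continuousAt
  rw [← hdd]
  by_contra! hneg
  have hgmax : IsLocalMax g 0 :=
    isLocalMax_of_deriv_deriv_neg hneg hgmin.deriv_eq_zero hgc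
  have hconst : g =ᶠ[nhds 0] fun _ => g 0 := by
    filter_upwards [hgmin, hgmax] with t h₁ h₂ using le_antisymm h₂ h₁
  have : deriv (deriv g) 0 = 0 := by
    rw [hconst.deriv.deriv_eq]
    simp
  exact hneg.ne this

theorem IsLocalMin.lap_nonneg {N : ℕ} {h : Euc N → ℝ} {x : Euc N} (hmin : IsLocalMin h x)
    (hh : ContDiffAt ℝ 2 h x) : 0 ≤ lap h x :=
  Finset.sum_nonneg fun _ _ => hmin.fderiv_fderiv_apply_nonneg hh _

theorem lap_const_mul_sub {N : ℕ} {u w : Euc N → ℝ} {x : Euc N} (hu : ContDiffAt ℝ 2 u x)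
    (hw : ContDiffAt ℝ 2 w x) (c : ℝ) :
    lap (fun y => c * u y - w y) x = c * lap u x - lap w x := by
  have hdiff {f : Euc N → ℝ} (hf : ContDiffAt ℝ 2 f x) :
      ∀ᶠ y in nhds x, DifferentiableAt ℝ f y :=
    (hf.eventually (by simp)).mono fun y hy => hy.differentiableAt (by norm_num)
  have hF {f : Euc N → ℝ} (hf : ContDiffAt ℝ 2 f x) (v : Euc N) :
      DifferentiableAt ℝ (fun y => fderiv ℝ f y v) x :=
    ((hf.fderiv_right (m := 1) (by norm_num)).differentiableAt (by norm_num)).clm_apply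
      (differentiableAt_const v)
  simp only [lap, Finset.mul_sum, ← Finset.sum_sub_distrib]
  refine Finset.sum_congr rfl fun i _ => ?_
  set v : Euc N := EuclideanSpace.single i 1
  have heq : (fun y => fderiv ℝ (fun y => c * u y - w y) y v) =ᶠ[nhds x]
      fun y => c * fderiv ℝ u y v - fderiv ℝ w y v := by
    filter_upwards [hdiff hu, hdiff hw] with y h₁ h₂
    rw [((h₁.hasFDerivAt.const_mul c).fun_sub h₂.hasFDerivAt).fderiv]
    simp
  rw [heq.fderiv_eq,
    (((hF hu v).hasFDerivAt.const_mul c).fun_sub (hF hw v).hasFDerivAt).fderiv]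
  simp

theorem lap_sq_sub_norm_sq_sq {N : ℕ} (r : ℝ) (x₀ x : Euc N) :
    lap (fun y => (r ^ 2 - ‖y - x₀‖ ^ 2) ^ 2) x
      = 8 * ‖x - x₀‖ ^ 2 - 4 * N * (r ^ 2 - ‖x - x₀‖ ^ 2) := by
  have hn (y : Euc N) : HasFDerivAt (fun y : Euc N => r ^ 2 - ‖y - x₀‖ ^ 2)
      (-(2 • (innerSL ℝ (y - x₀)))) y := by
    simpa using (((hasFDerivAt_id y).sub_const x₀).norm_sq).const_sub (r ^ 2)
  have h₁ (v : Euc N) : (fun y => fderiv ℝ (fun y => (r ^ 2 - ‖y - x₀‖ ^ 2) ^ 2) y v)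
      = fun y => -4 * ((r ^ 2 - ‖y - x₀‖ ^ 2) * inner ℝ (y - x₀) v) := by
    funext y
    rw [((hn y).pow 2).fderiv]
    simp [inner_sub_left]
    ring
  have h₂ (v : Euc N) : fderiv ℝ (fun y => -4 * ((r ^ 2 - ‖y - x₀‖ ^ 2) * inner ℝ (y - x₀) v)) x v
      = 8 * (inner ℝ (x - x₀) v) ^ 2 - 4 * (r ^ 2 - ‖x - x₀‖ ^ 2) * ‖v‖ ^ 2 := by
    have hi : HasFDerivAt (fun y : Euc N => inner ℝ (y - x₀) v) (innerSL ℝ v) x := by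
      have := (innerSL ℝ v).hasFDerivAt.comp x ((hasFDerivAt_id x).sub_const x₀)
      refine HasFDerivAt.congr_of_eventuallyEq (by simpa using this)
        (Eventually.of_forall fun y => ?_)
      simp [real_inner_comm]
    rw [(((hn x).fun_mul hi).const_mul (-4)).fderiv]
    simp [inner_sub_left]
    ring
  have hs : ∑ i, (inner ℝ (x - x₀) (EuclideanSpace.single i (1 : ℝ))) ^ 2 = ‖x - x₀‖ ^ 2 := by
    rw [EuclideanSpace.norm_sq_eq]
    simp [EuclideanSpace.inner_single_right]
  simp only [lap, h₁, h₂, Finset.sum_sub_distrib, ← Finset.mul_sum, hs]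
  simp
  ring

/-- A positive `C²` function on a closed ball of radius `r` cannot satisfy `Δu ≤ -λu` there
when `λ` is large compared with `r⁻²`. -/
theorem not_lap_le_neg_mul_on_closedBall {N : ℕ} {u : Euc N → ℝ} {x₀ : Euc N} {r lam : ℝ}
    (hr : 0 < r) (hlam : (4 * N + 8 : ℝ) ^ 2 < 32 * (lam * r ^ 2))
    (hu : ∀ x ∈ closedBall x₀ r, ContDiffAt ℝ 2 u x) (hpos : ∀ x ∈ closedBall x₀ r, 0 < u x)
    (hlap : ∀ x ∈ closedBall x₀ r, lap u x ≤ -(lam * u x)) : False := by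
  set w : Euc N → ℝ := fun y => (r ^ 2 - ‖y - x₀‖ ^ 2) ^ 2 with hw
  have hwC : ContDiff ℝ 2 w := by
    rw [hw]
    exact (contDiff_const.sub ((contDiff_id.sub contDiff_const).norm_sq ℝ)).pow 2
  obtain ⟨x, hx, hmax⟩ := (isCompact_closedBall x₀ r).exists_isMaxOn
    (f := fun y => w y / u y) ⟨x₀, mem_closedBall_self hr.le⟩
    (hwC.continuous.continuousOn.div
      (fun y hy => (hu y hy).continuousAt.continuousWithinAt) fun y hy => (hpos y hy).ne')
  set M := w x / u x with hM
  have hux := hpos x hx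
  have hMpos : 0 < M := by
    have h₀ : 0 < w x₀ / u x₀ :=
      div_pos (by simpa [hw] using pow_pos (pow_pos hr 2) 2)
        (hpos x₀ (mem_closedBall_self hr.le))
    exact h₀.trans_le (hmax (mem_closedBall_self hr.le))
  have hwx : w x = M * u x := by rw [hM]; field_simp
  have hle : ‖x - x₀‖ ≤ r := by simpa [dist_eq_norm] using hx
  have hlt : ‖x - x₀‖ < r := by
    refine lt_of_le_of_ne hle fun h => ?_
    have : w x = 0 := by simp [hw, h]
    exact (mul_pos hMpos hux).ne' (hwx ▸ this)
  have hmin : IsLocalMin (fun y => M * u y - w y) x := by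
    have : ball x₀ r ∈ nhds x := isOpen_ball.mem_nhds (by simpa [dist_eq_norm] using hlt)
    filter_upwards [this] with y hy
    have hy' := ball_subset_closedBall hy
    have h₁ : w y / u y ≤ M := hmax hy'
    rw [div_le_iff₀ (hpos y hy')] at h₁
    linarith
  have h₀ := hmin.lap_nonneg ((contDiffAt_const.mul (hu x hx)).sub hwC.contDiffAt)
  rw [lap_const_mul_sub (hu x hx) hwC.contDiffAt, lap_sq_sub_norm_sq_sq] at h₀
  have h₁ := mul_le_mul_of_nonneg_left (hlap x hx) hMpos.le
  set t := r ^ 2 - ‖x - x₀‖ ^ 2 with ht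
  have h₂ : M * u x = t ^ 2 := hwx.symm
  have h₃ : lam * t ^ 2 - (4 * N + 8) * t + 8 * r ^ 2 ≤ 0 := by
    have : M * -(lam * u x) = -(lam * t ^ 2) := by rw [← h₂]; ring
    linarith
  have htpos : 0 < t := sub_pos.mpr (pow_lt_pow_left₀ hlt (norm_nonneg _) two_ne_zero)
  have h₄ := mul_lt_mul_of_pos_right hlam (pow_pos htpos 2)
  have h₅ := mul_le_mul_of_nonneg_left h₃ (sq_nonneg r)
  linarith [sq_nonneg ((4 * N + 8) * t - 16 * r ^ 2)]

/-- Theorem 1.3 (nonexistence of positive fundamental solutions when the potential is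
large at infinity). -/
theorem nonexistence_fundamental_solution
    (N : ℕ) (hN : 3 ≤ N) (μ : ℝ) (hμ : 0 < μ) (hμ0 : μ < mu0 N) :
    ∃ βstar : ℝ, 1 < βstar ∧
      ∀ (V : Euc N → ℝ) (β : ℝ), βstar < β → AssumpVtilde N V β →
        ¬ ∃ (u : Euc N → ℝ) (k : ℝ), 0 < k ∧ (∀ x : Euc N, x ≠ 0 → 0 < u x) ∧
          IsSolution N μ V u ∧ DistribIdentity N μ V u k := by
  have hB : 0 < 9 * (4 * N + 8 : ℝ) ^ 2 / (32 * μ) := by positivity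
  refine ⟨1 + 9 * (4 * N + 8 : ℝ) ^ 2 / (32 * μ), by linarith, ?_⟩
  set B : ℝ := 1 + 9 * (4 * N + 8 : ℝ) ^ 2 / (32 * μ) with hBdef
  rintro V β hβ ⟨-, -, ⟨c₀, -, hV⟩, hlim⟩ ⟨u, k, -, hupos, ⟨huC, hueq⟩, -⟩
  have hbdd : IsBoundedUnder (· ≥ ·) (normAtTop N) (fun x : Euc N => V x * ‖x‖ ^ 2) := by
    refine isBoundedUnder_of_eventually_ge (a := 0) ?_
    filter_upwards [(tendsto_comap (f := norm) (x := atTop)).eventually (eventually_gt_atTop 0)]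
      with x hx
    have := (hV x (norm_pos_iff.mp hx)).1
    have : 0 ≤ ‖x‖ ^ (-2 : ℝ) := by positivity
    exact mul_nonneg (by linarith) (by positivity)
  have hev : ∀ᶠ x in normAtTop N, B < V x * ‖x‖ ^ 2 :=
    eventually_lt_of_lt_liminf (hlim ▸ hβ) hbdd
  obtain ⟨R, hR⟩ := eventually_atTop.mp (eventually_comap.mp hev)
  set r : ℝ := max R 1 with hrdef
  have hr : 0 < r := lt_max_of_lt_right one_pos
  set x₀ : Euc N := EuclideanSpace.single ⟨0, by omega⟩ (2 * r) with hx₀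
  have hx₀n : ‖x₀‖ = 2 * r := by simp [hx₀, abs_of_pos hr]
  have hnorm (x : Euc N) (hx : x ∈ closedBall x₀ r) : r ≤ ‖x‖ ∧ ‖x‖ ≤ 3 * r := by
    rw [mem_closedBall, dist_eq_norm] at hx
    have h₁ := norm_sub_norm_le x x₀
    have h₂ := norm_sub_norm_le x₀ x
    rw [norm_sub_rev] at h₂
    constructor <;> linarith
  have hne (x : Euc N) (hx : x ∈ closedBall x₀ r) : x ≠ 0 :=
    norm_pos_iff.mp (hr.trans_le (hnorm x hx).1)
  refine not_lap_le_neg_mul_on_closedBall (lam := μ * B / (9 * r ^ 2)) (x₀ := x₀) hr ?_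
    (fun x hx => huC.contDiffAt (isOpen_ne.mem_nhds (hne x hx)))
    (fun x hx => hupos x (hne x hx)) fun x hx => ?_
  · have : 32 * (μ * B / (9 * r ^ 2) * r ^ 2) = 32 * μ / 9 + (4 * N + 8 : ℝ) ^ 2 := by
      rw [hBdef]
      field_simp
    rw [this]
    linarith
  · obtain ⟨h₁, h₂⟩ := hnorm x hx
    have hxpos := hr.trans_le h₁
    have hBV := hR ‖x‖ ((le_max_left R 1).trans h₁) x rfl
    have hVB : B / (9 * r ^ 2) ≤ V x := by
      rw [div_le_iff₀ (by positivity)]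
      have hV0 : 0 ≤ V x :=
        (pos_of_mul_pos_left (lt_trans (by positivity) hBV) (by positivity)).le
      have : ‖x‖ ^ 2 ≤ 9 * r ^ 2 := by nlinarith
      exact hBV.le.trans (mul_le_mul_of_nonneg_left this hV0)
    have hmul := mul_le_mul_of_nonneg_right (mul_le_mul_of_nonneg_left hVB hμ.le)
      (hupos x (hne x hx)).le
    have := hueq x (hne x hx)
    rw [mul_div_assoc]
    linarith
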